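/- (Corollary 1, nonzero means.) Let σ_X > 0, σ_R > 0, ρ ∈ (−1, 1), μ_X, μ_R ∈ ℝ, and let (X, R) be a bivariate Gaussian random vector with means μ_X, μ_R, variances σ_X², σ_R², and correlation ρ. Write SR[X] = μ_X/σ_X and SR[R] = μ_R/σ_R. Then the Sharpe ratio of the product S = X·R satisfies SR[X·R] = E[XR]/√(Var(XR)) = (SR[R]·SR[X] + ρ) / (SR[R]² + SR[X]² + 2ρ·SR[R]·SR[X] + ρ² + 1)^{1/2}. -/

import Mathlib

open MeasureTheory Real

/-- The bivariate Gaussian measure on `ℝ × ℝ` with mean `(μX, μR)` and covariance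
matrix `[[σX², ρ σX σR], [ρ σX σR, σR²]]`, given by its Lebesgue density.  The first
coordinate is the signal `X`, the second the return `R`. -/
noncomputable def bivariateGaussianMeans (μX μR σX σR ρ : ℝ) : Measure (ℝ × ℝ) :=
  volume.withDensity fun p =>
    ENNReal.ofReal ((2 * π * σX * σR * Real.sqrt (1 - ρ ^ 2))⁻¹ *
      Real.exp (-(((p.1 - μX) / σX) ^ 2 -
          2 * ρ * ((p.1 - μX) / σX) * ((p.2 - μR) / σR) + ((p.2 - μR) / σR) ^ 2) /
        (2 * (1 - ρ ^ 2))))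

open ProbabilityTheory

/-- Powers of the coordinate are integrable against the standard Gaussian. -/
lemma integrable_pow_gaussianReal (n : ℕ) :
    Integrable (fun x : ℝ => x ^ n) (gaussianReal 0 1) := by
  simpa using (memLp_id_gaussianReal (μ := 0) (v := 1) n).integrable_norm_pow'.mono'
    (f := fun x : ℝ => x ^ n) (by fun_prop) (by simp)

lemma integrable_pow_mul_gaussianPDFReal (n : ℕ) :
    Integrable (fun x : ℝ => x ^ n * gaussianPDFReal 0 1 x) := by
  have h := integrable_pow_gaussianReal n
  rw [gaussianReal_of_var_ne_zero _ one_ne_zero,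
    integrable_withDensity_iff (measurable_gaussianPDF _ _)
      (ae_of_all _ fun _ => gaussianPDF_lt_top)] at h
  simpa using h

lemma hasDerivAt_gaussianPDFReal_zero_one (x : ℝ) :
    HasDerivAt (gaussianPDFReal 0 1) (-x * gaussianPDFReal 0 1 x) x := by
  have h : HasDerivAt (fun y : ℝ => -(y - 0) ^ 2 / (2 * ((1 : NNReal) : ℝ))) (-x) x :=
    (((hasDerivAt_id x).sub_const 0).pow 2).neg.div_const (2 * ((1 : NNReal) : ℝ))
      |>.congr_deriv (by simp; ring)
  refine (h.exp.const_mul (√(2 * π * ((1 : NNReal) : ℝ)))⁻¹).congr_deriv ?_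
  rw [gaussianPDFReal]
  ring

/-- The moment recursion of the standard Gaussian, by integration by parts. -/
lemma integral_pow_add_two_gaussianReal (n : ℕ) :
    ∫ x, x ^ (n + 2) ∂gaussianReal 0 1 = (n + 1) * ∫ x, x ^ n ∂gaussianReal 0 1 := by
  have hparts := integral_mul_deriv_eq_deriv_mul_of_integrable
    (u := fun x : ℝ => x ^ (n + 1)) (u' := fun x => (n + 1) * x ^ n)
    (v := gaussianPDFReal 0 1) (v' := fun x => -x * gaussianPDFReal 0 1 x)
    (fun x _ => by simpa using hasDerivAt_pow (n + 1) x)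
    (fun x _ => hasDerivAt_gaussianPDFReal_zero_one x)
    ((integrable_pow_mul_gaussianPDFReal (n + 2)).neg.congr
      (ae_of_all _ fun x => by simp only [Pi.neg_apply, Pi.mul_apply]; ring))
    (((integrable_pow_mul_gaussianPDFReal n).const_mul (n + 1 : ℝ)).congr
      (ae_of_all _ fun x => by simp only [Pi.mul_apply]; ring))
    (integrable_pow_mul_gaussianPDFReal (n + 1))
  rw [integral_gaussianReal_eq_integral_smul one_ne_zero,
    integral_gaussianReal_eq_integral_smul one_ne_zero, ← integral_const_mul]
  simp only [smul_eq_mul]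
  rw [← neg_inj, ← integral_neg]
  convert hparts using 1
  · congr 1; ext x; ring
  · congr 2; ext x; ring

/-- The affine map sending a standard Gaussian vector to a bivariate Gaussian one. -/
noncomputable def gaussianAffine (μX μR σX σR ρ : ℝ) (p : ℝ × ℝ) : ℝ × ℝ :=
  (μX + σX * p.1, μR + σR * (ρ * p.1 + √(1 - ρ ^ 2) * p.2))

lemma integral_gaussianReal_prod (f : ℝ × ℝ → ℝ) :
    ∫ p, f p ∂(gaussianReal 0 1).prod (gaussianReal 0 1) =
      ∫ p : ℝ × ℝ, (gaussianPDFReal 0 1 p.1 * gaussianPDFReal 0 1 p.2) * f p := by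
  rw [gaussianReal_of_var_ne_zero _ one_ne_zero,
    prod_withDensity (measurable_gaussianPDF _ _) (measurable_gaussianPDF _ _),
    integral_withDensity_eq_integral_toReal_smul
      (by fun_prop)
      (ae_of_all _ fun _ => ENNReal.mul_lt_top gaussianPDF_lt_top gaussianPDF_lt_top)]
  simp [Measure.volume_eq_prod]

/-- Integrals against the bivariate Gaussian reduce to a pair of independent standard
Gaussians. -/
lemma integral_bivariateGaussianMeans (μX μR : ℝ) {σX σR ρ : ℝ}
    (hσX : 0 < σX) (hσR : 0 < σR) (h1 : -1 < ρ) (h2 : ρ < 1) (f : ℝ × ℝ → ℝ) :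
    ∫ p, f p ∂bivariateGaussianMeans μX μR σX σR ρ =
      ∫ p, f (gaussianAffine μX μR σX σR ρ p)
        ∂(gaussianReal 0 1).prod (gaussianReal 0 1) := by
  have hρ : 0 < 1 - ρ ^ 2 := by nlinarith
  have hs : 0 < √(1 - ρ ^ 2) := Real.sqrt_pos.mpr hρ
  have hs2 : √(1 - ρ ^ 2) ^ 2 = 1 - ρ ^ 2 := Real.sq_sqrt hρ.le
  set s := √(1 - ρ ^ 2) with hs_def
  have hderiv (p : ℝ × ℝ) : HasFDerivAt (gaussianAffine μX μR σX σR ρ)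
      (Matrix.toLin (.finTwoProd ℝ) (.finTwoProd ℝ)
        !![σX, 0; σR * ρ, σR * s]).toContinuousLinearMap p := by
    rw [Matrix.toLin_finTwoProd_toContinuousLinearMap]
    have hX : HasFDerivAt (fun q : ℝ × ℝ => μX + σX * q.1)
        (σX • ContinuousLinearMap.fst ℝ ℝ ℝ) p :=
      (hasFDerivAt_fst.const_mul σX).const_add μX
    have hR : HasFDerivAt (fun q : ℝ × ℝ => μR + σR * (ρ * q.1 + s * q.2))
        (σR • (ρ • ContinuousLinearMap.fst ℝ ℝ ℝ + s • ContinuousLinearMap.snd ℝ ℝ ℝ)) p :=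
      (((hasFDerivAt_fst.const_mul ρ).add (hasFDerivAt_snd.const_mul s)).const_mul σR).const_add μR
    exact (hX.prodMk hR).congr_fderiv (by simp [smul_smul])
  have hinj : Function.Injective (gaussianAffine μX μR σX σR ρ) := by
    rintro ⟨a, b⟩ ⟨c, d⟩ h
    simp only [gaussianAffine, ← hs_def, Prod.mk.injEq, add_right_inj,
      mul_eq_mul_left_iff, hσX.ne', hσR.ne', or_false] at h
    obtain ⟨rfl, h⟩ := h
    simpa [hs.ne'] using h
  have hsurj : Function.Surjective (gaussianAffine μX μR σX σR ρ) := by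
    rintro ⟨x, r⟩
    refine ⟨((x - μX) / σX, ((r - μR) / σR - ρ * ((x - μX) / σX)) / s), ?_⟩
    simp only [gaussianAffine, ← hs_def, Prod.mk.injEq]
    constructor <;> field_simp <;> ring
  have hchange (g : ℝ × ℝ → ℝ) := integral_image_eq_integral_abs_det_fderiv_smul volume
    MeasurableSet.univ (fun p _ => (hderiv p).hasFDerivWithinAt) hinj.injOn g
  simp only [Set.image_univ, hsurj.range_eq, Measure.restrict_univ,
    LinearMap.det_toContinuousLinearMap, LinearMap.det_toLin, Matrix.det_fin_two_of] at hchange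
  rw [bivariateGaussianMeans, integral_withDensity_eq_integral_toReal_smul (by fun_prop)
    (ae_of_all _ fun _ => ENNReal.ofReal_lt_top), hchange, integral_gaussianReal_prod]
  refine integral_congr_ae (ae_of_all _ fun ⟨z, w⟩ => ?_)
  have hdet : |σX * (σR * s) - 0 * (σR * ρ)| = σX * σR * s := by
    rw [abs_of_pos] <;> [ring; (rw [zero_mul, sub_zero]; positivity)]
  have hexp : -(z ^ 2 - 2 * ρ * z * (ρ * z + s * w) + (ρ * z + s * w) ^ 2) / (2 * (1 - ρ ^ 2)) =
      -z ^ 2 / 2 + -w ^ 2 / 2 := by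
    rw [← hs2]
    field_simp
    linear_combination z ^ 2 * hs2
  have hπ : √(2 * π) ^ 2 = 2 * π := Real.sq_sqrt (by positivity)
  simp only [smul_eq_mul]
  rw [hdet, ENNReal.toReal_ofReal (by positivity)]
  simp only [gaussianAffine, ← hs_def, add_sub_cancel_left, mul_div_cancel_left₀ _ hσX.ne',
    mul_div_cancel_left₀ _ hσR.ne', hexp, Real.exp_add, gaussianPDFReal, NNReal.coe_one,
    sub_zero, mul_one]
  field_simp
  rw [hπ]
  ring

/-- Mixed moments of two independent standard Gaussians. -/
lemma integral_pow_mul_pow_gaussianReal_prod (i j : ℕ) :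
    ∫ p : ℝ × ℝ, p.1 ^ i * p.2 ^ j ∂(gaussianReal 0 1).prod (gaussianReal 0 1) =
      (∫ x, x ^ i ∂gaussianReal 0 1) * ∫ x, x ^ j ∂gaussianReal 0 1 :=
  integral_prod_mul (fun x : ℝ => x ^ i) (fun x : ℝ => x ^ j)

/-- Integrating a polynomial in two independent standard Gaussians term by term. -/
lemma integral_sum_gaussianReal_prod {ι : Type*} (t : Finset ι) (c : ι → ℝ) (i j : ι → ℕ) :
    ∫ p : ℝ × ℝ, ∑ k ∈ t, c k * (p.1 ^ i k * p.2 ^ j k)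
        ∂(gaussianReal 0 1).prod (gaussianReal 0 1) =
      ∑ k ∈ t, c k * ((∫ x, x ^ i k ∂gaussianReal 0 1) * ∫ x, x ^ j k ∂gaussianReal 0 1) := by
  rw [integral_finsetSum _ fun k _ =>
    ((integrable_pow_gaussianReal (i k)).mul_prod (integrable_pow_gaussianReal (j k))).const_mul _]
  simp only [integral_const_mul, integral_pow_mul_pow_gaussianReal_prod]

lemma integral_pow_two_gaussianReal : ∫ x, x ^ 2 ∂gaussianReal 0 1 = 1 := by
  simpa using integral_pow_add_two_gaussianReal 0

lemma integral_pow_three_gaussianReal : ∫ x, x ^ 3 ∂gaussianReal 0 1 = 0 := by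
  simpa using integral_pow_add_two_gaussianReal 1

lemma integral_pow_four_gaussianReal : ∫ x, x ^ 4 ∂gaussianReal 0 1 = 3 := by
  have h := integral_pow_add_two_gaussianReal 2
  rw [integral_pow_two_gaussianReal] at h
  norm_num at h
  exact h

/-- The mean of a quadratic polynomial in two independent standard Gaussians. -/
lemma integral_quadratic_gaussianReal_prod (m α β γ δ : ℝ) :
    ∫ p : ℝ × ℝ, (m + α * p.1 + β * p.2 + γ * (p.1 ^ 2 - 1) + δ * (p.1 * p.2))
        ∂(gaussianReal 0 1).prod (gaussianReal 0 1) = m := by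
  have h := integral_sum_gaussianReal_prod Finset.univ
    ![m - γ, α, β, γ, δ] ![0, 1, 0, 2, 1] ![0, 0, 1, 0, 1]
  simp [Fin.sum_univ_succ, integral_pow_two_gaussianReal] at h
  exact (integral_congr_ae (ae_of_all _ fun p => by ring)).trans h

/-- The second moment of a centred quadratic polynomial in two independent standard Gaussians. -/
lemma integral_sq_quadratic_gaussianReal_prod (α β γ δ : ℝ) :
    ∫ p : ℝ × ℝ, (α * p.1 + β * p.2 + γ * (p.1 ^ 2 - 1) + δ * (p.1 * p.2)) ^ 2
        ∂(gaussianReal 0 1).prod (gaussianReal 0 1) = α ^ 2 + β ^ 2 + 2 * γ ^ 2 + δ ^ 2 := by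
  have h := integral_sum_gaussianReal_prod Finset.univ
    ![γ ^ 2, 2 * α * γ, α ^ 2 - 2 * γ ^ 2, -2 * α * γ, γ ^ 2,
      2 * γ * δ, 2 * α * δ + 2 * β * γ, 2 * α * β - 2 * γ * δ, -2 * β * γ,
      δ ^ 2, 2 * β * δ, β ^ 2]
    ![4, 3, 2, 1, 0, 3, 2, 1, 0, 2, 1, 0] ![0, 0, 0, 0, 0, 1, 1, 1, 1, 2, 2, 2]
  simp [Fin.sum_univ_succ, integral_pow_two_gaussianReal, integral_pow_three_gaussianReal,
    integral_pow_four_gaussianReal] at h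
  refine ((integral_congr_ae (ae_of_all _ fun p => by ring)).trans h).trans ?_
  ring

/-- **Corollary 1 (nonzero means).** For `(X, R)` bivariate Gaussian with means
`μX, μR`, standard deviations `σX, σR > 0` and correlation `ρ ∈ (−1, 1)`, writing
`SR[X] = μX/σX` and `SR[R] = μR/σR`, the Sharpe ratio of the product `S = X·R` is
`SR[X·R] = (SR[R]·SR[X] + ρ)/(SR[R]² + SR[X]² + 2ρ·SR[R]·SR[X] + ρ² + 1)^{1/2}`. -/
theorem sharpeRatio_product_nonzero_means (μX μR σX σR ρ : ℝ)
    (hσX : 0 < σX) (hσR : 0 < σR) (h1 : -1 < ρ) (h2 : ρ < 1) :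
    (∫ p : ℝ × ℝ, p.1 * p.2 ∂(bivariateGaussianMeans μX μR σX σR ρ)) /
      Real.sqrt (∫ p : ℝ × ℝ,
        (p.1 * p.2 - ∫ q : ℝ × ℝ, q.1 * q.2 ∂(bivariateGaussianMeans μX μR σX σR ρ)) ^ 2
          ∂(bivariateGaussianMeans μX μR σX σR ρ)) =
    (μR / σR * (μX / σX) + ρ) /
      ((μR / σR) ^ 2 + (μX / σX) ^ 2 + 2 * ρ * (μR / σR) * (μX / σX) + ρ ^ 2 + 1) ^
        ((1 : ℝ) / 2) := by
  have hσ2 : √(1 - ρ ^ 2) ^ 2 = 1 - ρ ^ 2 := Real.sq_sqrt (by nlinarith)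
  have hmean : ∫ p : ℝ × ℝ, p.1 * p.2 ∂(bivariateGaussianMeans μX μR σX σR ρ) =
      μX * μR + σX * σR * ρ := by
    rw [integral_bivariateGaussianMeans μX μR hσX hσR h1 h2,
      ← integral_quadratic_gaussianReal_prod (μX * μR + σX * σR * ρ)
        (μX * σR * ρ + μR * σX) (μX * σR * √(1 - ρ ^ 2)) (σX * σR * ρ)
        (σX * σR * √(1 - ρ ^ 2))]
    congr 1; ext p; simp only [gaussianAffine]; ring
  have hvar : ∫ p : ℝ × ℝ, (p.1 * p.2 - (μX * μR + σX * σR * ρ)) ^ 2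
      ∂(bivariateGaussianMeans μX μR σX σR ρ) =
      (σX * σR) ^ 2 * ((μR / σR) ^ 2 + (μX / σX) ^ 2 + 2 * ρ * (μR / σR) * (μX / σX) +
        ρ ^ 2 + 1) := by
    rw [integral_bivariateGaussianMeans μX μR hσX hσR h1 h2]
    transitivity
    · convert integral_sq_quadratic_gaussianReal_prod
        (μX * σR * ρ + μR * σX) (μX * σR * √(1 - ρ ^ 2)) (σX * σR * ρ)
        (σX * σR * √(1 - ρ ^ 2)) using 2
      ext p; simp only [gaussianAffine]; ring
    · simp only [mul_pow _ (√(1 - ρ ^ 2)), hσ2]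
      field_simp
      ring
  rw [hmean, hvar, Real.sqrt_mul (sq_nonneg _), Real.sqrt_sq (by positivity),
    ← Real.sqrt_eq_rpow]
  have hnum : μX * μR + σX * σR * ρ = (σX * σR) * (μR / σR * (μX / σX) + ρ) := by
    field_simp
  rw [hnum, mul_div_mul_left _ _ (by positivity)]
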